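/- Telescoped translated Cauchy sequences converge: let (v^n) be a sequence in L² and (q_n) a sequence in ℝ^d such that ‖τ_{q_n} v^n − v^{n+1}‖₂ + |q_n| < 2^{−n} for all n. Then (v^n) converges strongly in L², i.e. there exists v ∈ L² with ‖v^n − v‖₂ → 0. -/

import Mathlib

open MeasureTheory Filter

noncomputable section

/-- Translation `(τ_q v)(x) = v(x - q)` acting on `L²(ℝ^d; ℝ)`. -/
def tau {d : ℕ} (q : EuclideanSpace ℝ (Fin d))
    (v : Lp ℝ 2 (volume : Measure (EuclideanSpace ℝ (Fin d)))) :
    Lp ℝ 2 (volume : Measure (EuclideanSpace ℝ (Fin d))) :=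
  Lp.compMeasurePreserving (fun x => x - q) (measurePreserving_sub_right volume q) v

/-- The squared mobile distance
`m_φ(v⁰, v¹)² = inf { ‖v^{1−j} − τ_q v^j‖₂² + |q|² φ(‖v^j‖₂)² : q ∈ ℝ^d, j ∈ {0,1} }`. -/
def mobSq {d : ℕ} (φ : ℝ → ℝ)
    (v0 v1 : Lp ℝ 2 (volume : Measure (EuclideanSpace ℝ (Fin d)))) : ℝ :=
  sInf {r : ℝ | ∃ q : EuclideanSpace ℝ (Fin d),
      r = ‖v1 - tau q v0‖ ^ 2 + ‖q‖ ^ 2 * φ ‖v0‖ ^ 2 ∨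
      r = ‖v0 - tau q v1‖ ^ 2 + ‖q‖ ^ 2 * φ ‖v1‖ ^ 2}

/-- The mobile distance `m_φ`. -/
def mob {d : ℕ} (φ : ℝ → ℝ)
    (v0 v1 : Lp ℝ 2 (volume : Measure (EuclideanSpace ℝ (Fin d)))) : ℝ :=
  Real.sqrt (mobSq φ v0 v1)

end

/-- Translations compose additively. -/
theorem tau_tau {d : ℕ} (a b : EuclideanSpace ℝ (Fin d))
    (v : Lp ℝ 2 (volume : Measure (EuclideanSpace ℝ (Fin d)))) :
    tau a (tau b v) = tau (a + b) v := by
  unfold tau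
  rw [← Lp.compMeasurePreserving_comp_apply]
  congr 2
  funext x
  simp [sub_sub]

theorem tau_zero {d : ℕ} (v : Lp ℝ 2 (volume : Measure (EuclideanSpace ℝ (Fin d)))) :
    tau 0 v = v := by
  conv_rhs => rw [← Lp.compMeasurePreserving_id_apply v]
  unfold tau
  congr 2
  funext x
  simp

theorem isometry_tau {d : ℕ} (q : EuclideanSpace ℝ (Fin d)) : Isometry (tau q) :=
  Lp.isometry_compMeasurePreserving (measurePreserving_sub_right volume q)

/-- Translation is jointly continuous in the shift and in the translated function. -/
theorem continuous_tau {d : ℕ} :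
    Continuous fun p : EuclideanSpace ℝ (Fin d) ×
      Lp ℝ 2 (volume : Measure (EuclideanSpace ℝ (Fin d))) => tau p.1 p.2 := by
  let g : EuclideanSpace ℝ (Fin d) × Lp ℝ 2 (volume : Measure (EuclideanSpace ℝ (Fin d))) →
      C(EuclideanSpace ℝ (Fin d), EuclideanSpace ℝ (Fin d)) :=
    fun p => ⟨fun x => x - p.1, by fun_prop⟩
  have hg : Continuous g := by
    apply ContinuousMap.continuous_of_continuous_uncurry
    change Continuous fun y : (EuclideanSpace ℝ (Fin d) ×
      Lp ℝ 2 (volume : Measure (EuclideanSpace ℝ (Fin d)))) × EuclideanSpace ℝ (Fin d) =>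
        y.2 - y.1.1
    fun_prop
  exact continuous_snd.compMeasurePreservingLp hg
    (fun p => measurePreserving_sub_right volume p.1) ENNReal.ofNat_ne_top

/-- **Telescoped translated Cauchy sequences converge**: if `(v^n)` in `L²` and `(q_n)`
in `ℝ^d` satisfy `‖τ_{q_n} v^n − v^{n+1}‖₂ + |q_n| < 2^{−n}` for all `n`, then `(v^n)`
converges strongly in `L²`. -/
theorem translated_telescoping_cauchy_converges {d : ℕ} (hd : 0 < d)
    (v : ℕ → Lp ℝ 2 (volume : Measure (EuclideanSpace ℝ (Fin d))))
    (q : ℕ → EuclideanSpace ℝ (Fin d))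
    (h : ∀ n : ℕ, ‖tau (q n) (v n) - v (n + 1)‖ + ‖q n‖ < (1 / 2 : ℝ) ^ n) :
    ∃ w : Lp ℝ 2 (volume : Measure (EuclideanSpace ℝ (Fin d))),
      Tendsto (fun n => ‖v n - w‖) atTop (nhds 0) := by
  let S : ℕ → EuclideanSpace ℝ (Fin d) := fun n => ∑ k ∈ Finset.range n, q k
  have hS_succ (n : ℕ) : S (n + 1) = S n + q n := Finset.sum_range_succ q n
  have hS : CauchySeq S := by
    refine cauchySeq_of_le_geometric (1 / 2) 1 (by norm_num) fun n => ?_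
    rw [hS_succ, dist_self_add_right, one_mul]
    linarith [h n, norm_nonneg (tau (q n) (v n) - v (n + 1))]
  have hu : CauchySeq fun n => tau (-S n) (v n) := by
    refine cauchySeq_of_le_geometric (1 / 2) 1 (by norm_num) fun n => ?_
    have hn : tau (-S n) (v n) = tau (-S (n + 1)) (tau (q n) (v n)) := by
      rw [tau_tau, hS_succ, neg_add, neg_add_cancel_right]
    rw [hn, (isometry_tau _).dist_eq, dist_eq_norm, one_mul]
    linarith [h n, norm_nonneg (q n)]
  obtain ⟨s, hs⟩ := cauchySeq_tendsto_of_complete hS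
  obtain ⟨u, hu⟩ := cauchySeq_tendsto_of_complete hu
  refine ⟨tau s u, tendsto_iff_norm_sub_tendsto_zero.1 ?_⟩
  simpa [Function.comp_def, tau_tau, tau_zero] using
    (continuous_tau.tendsto (s, u)).comp (hs.prodMk_nhds hu)
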